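/- arXiv:1405.2502 — 2 statements merged into one kernel-verified Lean document; each statement's English description precedes it below -/
import Mathlib

section
/- Let ρ_AB be a bipartite density matrix whose marginals ρ_A and ρ_B are invertible (full rank), and define ρ̃_AB = (I_A ⊗ ρ_B^{-1/2}) ρ_AB (ρ_A^{-1/2} ⊗ I_B). Viewing ρ̃_AB as a vector in the tensor product Hilbert space L(H_A) ⊗ L(H_B) (with the Hilbert–Schmidt inner product on each factor), its largest Schmidt coefficient equals 1 and its second largest Schmidt coefficient equals μ(ρ_AB). -/
open scoped Matrix Kronecker ComplexOrder
open Matrix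

noncomputable section

/-- Partial trace over the second (B) system. -/
def ptrB {A B : Type*} [Fintype B] (ρ : Matrix (A × B) (A × B) ℂ) : Matrix A A ℂ :=
  fun i j => ∑ k, ρ (i, k) (j, k)

/-- Partial trace over the first (A) system. -/
def ptrA {A B : Type*} [Fintype A] (ρ : Matrix (A × B) (A × B) ℂ) : Matrix B B ℂ :=
  fun k l => ∑ i, ρ (i, k) (i, l)

/-- A density matrix: positive semidefinite with trace one. -/
def IsDensity {n : Type*} [Fintype n] (ρ : Matrix n n ℂ) : Prop :=
  ρ.PosSemidef ∧ ρ.trace = 1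

/-- Maximal correlation of a bipartite state. -/
def mu {A B : Type*} [Fintype A] [Fintype B] (ρ : Matrix (A × B) (A × B) ℂ) : ℝ :=
  sSup {r : ℝ | ∃ (X : Matrix A A ℂ) (Y : Matrix B B ℂ),
    ((ptrB ρ) * X).trace = 0 ∧ ((ptrA ρ) * Y).trace = 0 ∧
    ((ptrB ρ) * (X * Xᴴ)).trace = 1 ∧ ((ptrA ρ) * (Y * Yᴴ)).trace = 1 ∧
    r = ‖(ρ * (X ⊗ₖ Yᴴ)).trace‖}

/-- Maximal entanglement: infimum over finite decompositions of the max correlation. -/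
def muEnt {A B : Type*} [Fintype A] [Fintype B] (ρ : Matrix (A × B) (A × B) ℂ) : ℝ :=
  sInf {r : ℝ | ∃ (m : ℕ) (p : Fin m → ℝ) (τ : Fin m → Matrix (A × B) (A × B) ℂ),
    (∀ i, 0 ≤ p i) ∧ (∑ i, p i) = 1 ∧ (∀ i, IsDensity (τ i)) ∧
    ρ = ∑ i, p i • τ i ∧ r = ⨆ i, mu (τ i)}

/-- Application of a product channel given by local Kraus operators. -/
def applyLocal {A B A' B' ι κ : Type*} [Fintype A] [Fintype B] [Fintype ι] [Fintype κ]
    (K : ι → Matrix A' A ℂ) (L : κ → Matrix B' B ℂ)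
    (ρ : Matrix (A × B) (A × B) ℂ) : Matrix (A' × B') (A' × B') ℂ :=
  ∑ k, ∑ m, (K k ⊗ₖ L m) * ρ * (K k ⊗ₖ L m)ᴴ

/-- Tensor product of two bipartite states, with the A-systems grouped together. -/
def prodState {A B A' B' : Type*}
    (ρ : Matrix (A × B) (A × B) ℂ) (σ : Matrix (A' × B') (A' × B') ℂ) :
    Matrix ((A × A') × (B × B')) ((A × A') × (B × B')) ℂ :=
  fun x y => ρ (x.1.1, x.2.1) (y.1.1, y.2.1) * σ (x.1.2, x.2.2) (y.1.2, y.2.2)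

/-- n-fold tensor power of a bipartite state, with all A-systems grouped together. -/
def powState {A B : Type*} (ρ : Matrix (A × B) (A × B) ℂ) (n : ℕ) :
    Matrix ((Fin n → A) × (Fin n → B)) ((Fin n → A) × (Fin n → B)) ℂ :=
  fun x y => ∏ i, ρ (x.1 i, x.2 i) (y.1 i, y.2 i)

/-- The two-qubit Bell vector (|00⟩+|11⟩)/√2. -/
def bellVec : Fin 2 × Fin 2 → ℂ := fun p => if p.1 = p.2 then 1 / (Real.sqrt 2 : ℂ) else 0

/-- The positive semidefinite square root of a positive semidefinite matrix
(Mathlib's former `Matrix.PosSemidef.sqrt`). -/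
def Matrix.PosSemidef.sqrt {n : Type*} [Fintype n] [DecidableEq n] {M : Matrix n n ℂ}
    (hM : M.PosSemidef) : Matrix n n ℂ :=
  hM.1.eigenvectorUnitary.1 * diagonal ((↑) ∘ Real.sqrt ∘ hM.1.eigenvalues) *
    (star hM.1.eigenvectorUnitary : Matrix n n ℂ)

/-- Inverse of the positive semidefinite square root. -/
def invSqrt {n : Type*} [Fintype n] [DecidableEq n] (M : Matrix n n ℂ) : Matrix n n ℂ :=
  letI := Classical.dec M.PosSemidef
  if h : M.PosSemidef then h.sqrt⁻¹ else 0


/-- Realignment of a bipartite matrix: `M (i,k) (j,l) = ρ (i,j) (k,l)`. -/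
def realign {dA dB : ℕ} (M : Matrix (Fin dA × Fin dB) (Fin dA × Fin dB) ℂ) :
    Matrix (Fin dA × Fin dA) (Fin dB × Fin dB) ℂ :=
  fun r c => M (r.1, c.1) (r.2, c.2)

open scoped InnerProductSpace ComplexConjugate

/-- If a contraction `T` has `v` as a singular vector with singular value `1`, then its second
largest singular value is the supremum of `‖⟪x, T y⟫‖` over unit vectors `x ⟂ T v`, `y ⟂ v`. -/
theorem sSup_norm_inner_map_orthogonal_eq_iSup {ι E F : Type*} [Fintype ι]
    [NormedAddCommGroup E] [InnerProductSpace ℂ E] [NormedAddCommGroup F] [InnerProductSpace ℂ F]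
    (T : F →ₗ[ℂ] E) (e : OrthonormalBasis ι ℂ F) (l : ι → ℝ)
    (he : ∀ j y, ⟪T (e j), T y⟫_ℂ = l j * ⟪e j, y⟫_ℂ) (hT : ∀ y, ‖T y‖ ≤ ‖y‖)
    (v : F) (hv : ‖v‖ = 1) (hTv : ∀ y, ⟪T v, T y⟫_ℂ = ⟪v, y⟫_ℂ) :
    ∃ j₀, (∀ j, √(l j) ≤ √(l j₀)) ∧ √(l j₀) = 1 ∧
      sSup {r : ℝ | ∃ x y, ⟪x, T v⟫_ℂ = 0 ∧ ⟪y, v⟫_ℂ = 0 ∧ ‖x‖ = 1 ∧ ‖y‖ = 1 ∧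
        r = ‖⟪x, T y⟫_ℂ‖} = ⨆ j : {j // j ≠ j₀}, √(l j) := by
  have hl : ∀ j, l j = ‖T (e j)‖ ^ 2 := by
    intro j
    have h := he j (e j)
    rw [inner_self_eq_norm_sq_to_K, inner_self_eq_norm_sq_to_K, e.norm_eq_one] at h
    norm_num at h
    exact_mod_cast h.symm
  have hl0 : ∀ j, 0 ≤ l j := fun j => hl j ▸ sq_nonneg _
  have hl1 : ∀ j, √(l j) ≤ 1 := by
    intro j
    rw [hl, Real.sqrt_sq (norm_nonneg _)]
    exact (hT _).trans_eq (e.norm_eq_one j)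
  have hvj : ∀ j, ⟪e j, v⟫_ℂ = 0 ∨ l j = 1 := by
    intro j
    have h1 := he j v
    have h2 := hTv (e j)
    rw [← inner_conj_symm, h2, inner_conj_symm] at h1
    by_cases h : ⟪e j, v⟫_ℂ = 0
    · exact Or.inl h
    · right
      have : (1 : ℂ) = l j := mul_right_cancel₀ h (by rw [one_mul]; exact h1)
      exact_mod_cast this.symm
  have hTn : ∀ y, ‖T y‖ ^ 2 = ∑ j, l j * ‖⟪e j, y⟫_ℂ‖ ^ 2 := by
    intro y
    have h : ⟪T y, T y⟫_ℂ = ∑ j, ((l j * ‖⟪e j, y⟫_ℂ‖ ^ 2 : ℝ) : ℂ) := by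
      conv_lhs => enter [2]; rw [← e.sum_repr y]
      rw [map_sum, sum_inner]
      refine Finset.sum_congr rfl fun j _ => ?_
      rw [map_smul, inner_smul_left, he, e.repr_apply_apply]
      push_cast
      rw [← Complex.conj_mul']
      ring
    rw [inner_self_eq_norm_sq_to_K] at h
    apply Complex.ofReal_injective
    simpa using h
  obtain ⟨j₀, hj₀⟩ : ∃ j, ⟪e j, v⟫_ℂ ≠ 0 := by
    by_contra! h
    have := e.sum_sq_norm_inner_right v
    simp [h, hv] at this
  have hlj₀ : l j₀ = 1 := (hvj j₀).resolve_left hj₀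
  have hsj₀ : √(l j₀) = 1 := by simp [hlj₀]
  refine ⟨j₀, fun j => (hl1 j).trans_eq hsj₀.symm, hsj₀, ?_⟩
  have hbdd : BddAbove (Set.range fun j : {j // j ≠ j₀} => √(l j)) :=
    ⟨1, by rintro _ ⟨j, rfl⟩; exact hl1 j⟩
  have hs0 : 0 ≤ ⨆ j : {j // j ≠ j₀}, √(l j) := Real.iSup_nonneg fun j => Real.sqrt_nonneg _
  apply le_antisymm
  · refine Real.sSup_le ?_ hs0
    rintro r ⟨x, y, -, hy, hx1, hy1, rfl⟩
    have hxy : ‖⟪x, T y⟫_ℂ‖ ≤ ‖T y‖ := by simpa [hx1] using norm_inner_le_norm (𝕜 := ℂ) x (T y)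
    refine hxy.trans ?_
    set s := ⨆ j : {j // j ≠ j₀}, √(l j) with hs
    by_cases hs1 : 1 ≤ s
    · exact ((hT y).trans_eq hy1).trans hs1
    have hls : ∀ j, j ≠ j₀ → √(l j) ≤ s := fun j hj => le_ciSup hbdd ⟨j, hj⟩
    have hvz : ∀ j, j ≠ j₀ → ⟪e j, v⟫_ℂ = 0 := fun j hj =>
      (hvj j).resolve_right fun h => hs1 (by simpa [h] using hls j hj)
    have hyj₀ : ⟪e j₀, y⟫_ℂ = 0 := by
      rw [← e.sum_inner_mul_inner, Finset.sum_eq_single j₀ (fun j _ hj => by simp [hvz j hj])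
        (by simp)] at hy
      rw [← inner_conj_symm, (mul_eq_zero.1 hy).resolve_right hj₀, map_zero]
    refine le_of_sq_le_sq ?_ hs0
    calc ‖T y‖ ^ 2 = ∑ j, l j * ‖⟪e j, y⟫_ℂ‖ ^ 2 := hTn y
      _ ≤ ∑ j, s ^ 2 * ‖⟪e j, y⟫_ℂ‖ ^ 2 := by
        refine Finset.sum_le_sum fun j _ => ?_
        by_cases hj : j = j₀
        · simp [hj, hyj₀]
        · gcongr
          exact (Real.sqrt_le_left hs0).1 (hls j hj)
      _ = s ^ 2 := by rw [← Finset.mul_sum, e.sum_sq_norm_inner_right, hy1]; ring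
  · refine Real.iSup_le ?_ (Real.sSup_nonneg (by rintro _ ⟨x, y, -, -, -, -, rfl⟩; positivity))
    rintro ⟨j, hj⟩
    rcases (hl0 j).eq_or_lt with h0 | h0
    · simp only [← h0, Real.sqrt_zero]
      exact Real.sSup_nonneg (by rintro _ ⟨x, y, -, -, -, -, rfl⟩; positivity)
    obtain ⟨y, hyv, hy1, hTy⟩ : ∃ y, ⟪y, v⟫_ℂ = 0 ∧ ‖y‖ = 1 ∧ √(l j) ≤ ‖T y‖ := by
      set z := conj ⟪e j₀, v⟫_ℂ • e j - conj ⟪e j, v⟫_ℂ • e j₀ with hz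
      have hzj : ⟪e j, z⟫_ℂ ≠ 0 := by
        rw [hz, inner_sub_right, inner_smul_right, inner_smul_right,
          e.inner_eq_zero hj, inner_self_eq_norm_sq_to_K, e.norm_eq_one]
        simpa [-inner_conj_symm] using hj₀
      have hz0 : ‖z‖ ≠ 0 := fun h => hzj (by rw [norm_eq_zero.1 h, inner_zero_right])
      have hTz : √(l j) * ‖z‖ ≤ ‖T z‖ := by
        refine le_of_sq_le_sq ?_ (norm_nonneg _)
        rw [mul_pow, Real.sq_sqrt (hl0 j), hTn, ← e.sum_sq_norm_inner_right, Finset.mul_sum]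
        refine Finset.sum_le_sum fun i _ => ?_
        by_cases hij : i = j
        · rw [hij]
        by_cases hij₀ : i = j₀
        · rw [hij₀, hlj₀]
          gcongr
          simpa using hl1 j
        · rw [hz, inner_sub_right, inner_smul_right, inner_smul_right,
            e.inner_eq_zero hij, e.inner_eq_zero hij₀]
          simp
      refine ⟨(‖z‖ : ℂ)⁻¹ • z, ?_, ?_, ?_⟩
      · rw [inner_smul_left, hz, inner_sub_left, inner_smul_left, inner_smul_left,
          Complex.conj_conj, Complex.conj_conj]
        ring
      · rw [norm_smul, norm_inv, Complex.norm_real, norm_norm, inv_mul_cancel₀ hz0]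
      · rw [map_smul, norm_smul, norm_inv, Complex.norm_real, norm_norm, ← div_eq_inv_mul,
          le_div_iff₀ (by positivity)]
        exact hTz
    have hTy0 : (‖T y‖ : ℂ) ≠ 0 := by exact_mod_cast ((Real.sqrt_pos.2 h0).trans_le hTy).ne'
    refine hTy.trans (le_csSup ⟨1, ?_⟩ ⟨(‖T y‖ : ℂ)⁻¹ • T y, y, ?_, hyv, ?_, hy1, ?_⟩)
    · rintro _ ⟨x, y, -, -, hx, hy, rfl⟩
      exact (norm_inner_le_norm (𝕜 := ℂ) x (T y)).trans (by simpa [hx, hy] using hT y)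
    · rw [inner_smul_left, ← inner_conj_symm, hTv, inner_conj_symm, hyv, mul_zero]
    · rw [norm_smul, norm_inv, Complex.norm_real, norm_norm]
      exact inv_mul_cancel₀ (by exact_mod_cast hTy0)
    · rw [inner_smul_left, inner_self_eq_norm_sq_to_K]; simp; field_simp

theorem trace_mul_kronecker_one {A B : Type*} [Fintype A] [Fintype B] [DecidableEq B]
    (ρ : Matrix (A × B) (A × B) ℂ) (X : Matrix A A ℂ) :
    (ρ * (X ⊗ₖ (1 : Matrix B B ℂ))).trace = (ptrB ρ * X).trace := by
  simp only [trace, diag, mul_apply, Fintype.sum_prod_type, kroneckerMap_apply, ptrB, one_apply,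
    mul_ite, mul_one, mul_zero, Finset.sum_ite_eq', Finset.mem_univ, if_true, Finset.sum_mul]
  exact Finset.sum_congr rfl fun _ _ => Finset.sum_comm

theorem trace_mul_one_kronecker {A B : Type*} [Fintype A] [Fintype B] [DecidableEq A]
    (ρ : Matrix (A × B) (A × B) ℂ) (Y : Matrix B B ℂ) :
    (ρ * ((1 : Matrix A A ℂ) ⊗ₖ Y)).trace = (ptrA ρ * Y).trace := by
  simp only [trace, diag, mul_apply, Fintype.sum_prod_type_right, kroneckerMap_apply, ptrA,
    one_apply, ite_mul, mul_ite, one_mul, zero_mul, mul_zero, Finset.sum_ite_eq', Finset.mem_univ,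
    if_true, Finset.sum_mul]
  exact Finset.sum_congr rfl fun _ _ => Finset.sum_comm

theorem Matrix.PosSemidef.ptrB {A B : Type*} [Fintype A] [Fintype B]
    {ρ : Matrix (A × B) (A × B) ℂ} (hρ : ρ.PosSemidef) : (ptrB ρ).PosSemidef := by
  have h : _root_.ptrB ρ = ∑ k, ρ.submatrix (fun i => (i, k)) (fun i => (i, k)) := by
    ext i j
    simp [_root_.ptrB, Matrix.sum_apply]
  rw [h]
  exact posSemidef_sum _ fun k _ => hρ.submatrix _

theorem Matrix.PosSemidef.ptrA {A B : Type*} [Fintype A] [Fintype B]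
    {ρ : Matrix (A × B) (A × B) ℂ} (hρ : ρ.PosSemidef) : (ptrA ρ).PosSemidef := by
  have h : _root_.ptrA ρ = ∑ i, ρ.submatrix (fun k => (i, k)) (fun k => (i, k)) := by
    ext k l
    simp [_root_.ptrA, Matrix.sum_apply]
  rw [h]
  exact posSemidef_sum _ fun i _ => hρ.submatrix _

theorem Matrix.PosSemidef.sqrt_mul_sqrt {n : Type*} [Fintype n] [DecidableEq n]
    {M : Matrix n n ℂ} (hM : M.PosSemidef) : hM.sqrt * hM.sqrt = M := by
  have hU : (star hM.1.eigenvectorUnitary : Matrix n n ℂ) * hM.1.eigenvectorUnitary.1 = 1 :=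
    Unitary.coe_star_mul_self _
  have hD : diagonal (((↑) : ℝ → ℂ) ∘ Real.sqrt ∘ hM.1.eigenvalues) *
      diagonal (((↑) : ℝ → ℂ) ∘ Real.sqrt ∘ hM.1.eigenvalues) =
      diagonal (RCLike.ofReal ∘ hM.1.eigenvalues) := by
    rw [diagonal_mul_diagonal]
    congr 1
    ext i
    simp [← Complex.ofReal_mul, Real.mul_self_sqrt (hM.eigenvalues_nonneg i)]
  conv_rhs => rw [hM.1.spectral_theorem, Unitary.conjStarAlgAut_apply, ← hD]
  simp only [Matrix.PosSemidef.sqrt, Matrix.mul_assoc]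
  rw [← Matrix.mul_assoc _ hM.1.eigenvectorUnitary.1, hU, Matrix.one_mul]

theorem Matrix.PosSemidef.conjTranspose_sqrt {n : Type*} [Fintype n] [DecidableEq n]
    {M : Matrix n n ℂ} (hM : M.PosSemidef) : hM.sqrtᴴ = hM.sqrt := by
  have hD : (diagonal (((↑) : ℝ → ℂ) ∘ Real.sqrt ∘ hM.1.eigenvalues))ᴴ =
      diagonal (((↑) : ℝ → ℂ) ∘ Real.sqrt ∘ hM.1.eigenvalues) := by
    rw [diagonal_conjTranspose]
    congr 1
    ext i
    simp
  simp only [Matrix.PosSemidef.sqrt, conjTranspose_mul, hD, Matrix.mul_assoc,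
    star_eq_conjTranspose, conjTranspose_conjTranspose]

theorem Matrix.PosSemidef.isUnit_sqrt {n : Type*} [Fintype n] [DecidableEq n]
    {M : Matrix n n ℂ} (hM : M.PosSemidef) (hu : IsUnit M) : IsUnit hM.sqrt.det := by
  rw [isUnit_iff_isUnit_det, ← hM.sqrt_mul_sqrt, det_mul] at hu
  exact isUnit_of_mul_isUnit_left hu

theorem invSqrt_eq {n : Type*} [Fintype n] [DecidableEq n]
    {M : Matrix n n ℂ} (hM : M.PosSemidef) : invSqrt M = hM.sqrt⁻¹ := by
  simp [invSqrt, hM]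

theorem vec_dotProduct_realign_mulVec {dA dB : ℕ}
    (R : Matrix (Fin dA × Fin dB) (Fin dA × Fin dB) ℂ)
    (P : Matrix (Fin dA) (Fin dA) ℂ) (Q : Matrix (Fin dB) (Fin dB) ℂ) :
    vec P ⬝ᵥ (realign R *ᵥ star (vec Qᵀ)) = (R * (P ⊗ₖ Qᴴ)).trace := by
  simp only [trace, diag, mul_apply, Fintype.sum_prod_type, kroneckerMap_apply, dotProduct,
    mulVec, realign, vec, Finset.mul_sum, Pi.star_apply, transpose_apply, conjTranspose_apply]
  refine Finset.sum_congr rfl fun i _ => ?_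
  rw [Finset.sum_comm]
  refine Finset.sum_congr rfl fun j _ => Finset.sum_congr rfl fun k _ =>
    Finset.sum_congr rfl fun l _ => by ring

theorem trace_normalized_mul_kronecker {dA dB : ℕ}
    {ρ : Matrix (Fin dA × Fin dB) (Fin dA × Fin dB) ℂ}
    (hρA : (ptrB ρ).PosSemidef) (hρB : (ptrA ρ).PosSemidef)
    (hA : IsUnit (ptrB ρ)) (hB : IsUnit (ptrA ρ))
    (X : Matrix (Fin dA) (Fin dA) ℂ) (Y : Matrix (Fin dB) (Fin dB) ℂ) :
    (((1 ⊗ₖ invSqrt (ptrA ρ)) * ρ * (invSqrt (ptrB ρ) ⊗ₖ 1)) *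
      ((hρA.sqrt * X) ⊗ₖ (hρB.sqrt * Y)ᴴ)).trace = (ρ * (X ⊗ₖ Yᴴ)).trace := by
  rw [Matrix.mul_assoc, Matrix.mul_assoc, trace_mul_comm, Matrix.mul_assoc, Matrix.mul_assoc,
    ← mul_kronecker_mul, ← mul_kronecker_mul, invSqrt_eq hρA, invSqrt_eq hρB, one_mul, mul_one,
    nonsing_inv_mul_cancel_left _ _ (hρA.isUnit_sqrt hA), conjTranspose_mul,
    hρB.conjTranspose_sqrt, mul_nonsing_inv_cancel_right _ _ (hρB.isUnit_sqrt hB)]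

theorem norm_trace_mul_kronecker_sq_le {A B : Type*} [Fintype A] [Fintype B]
    [DecidableEq A] [DecidableEq B] {ρ : Matrix (A × B) (A × B) ℂ} (hρ : ρ.PosSemidef)
    (X : Matrix A A ℂ) (Y : Matrix B B ℂ) :
    ‖(ρ * (X ⊗ₖ Yᴴ)).trace‖ ^ 2 ≤
      (ptrB ρ * (X * Xᴴ)).trace.re * (ptrA ρ * (Y * Yᴴ)).trace.re := by
  have hs : ∀ P Q : Matrix (A × B) (A × B) ℂ,
      inner ℂ (WithLp.toLp 2 (vec (hρ.sqrt * Q))) (WithLp.toLp 2 (vec (hρ.sqrt * P))) =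
        (ρ * (P * Qᴴ)).trace := by
    intro P Q
    rw [EuclideanSpace.inner_toLp_toLp, dotProduct_comm, star_vec_dotProduct_vec,
      conjTranspose_mul, hρ.conjTranspose_sqrt, Matrix.mul_assoc, ← Matrix.mul_assoc _ _ P,
      hρ.sqrt_mul_sqrt, trace_mul_comm, Matrix.mul_assoc]
  have hX := hs (X ⊗ₖ 1) (X ⊗ₖ 1)
  have hY := hs (1 ⊗ₖ Y) (1 ⊗ₖ Y)
  have hXY := hs (X ⊗ₖ 1) (1 ⊗ₖ Y)
  rw [conjTranspose_kronecker, ← mul_kronecker_mul, conjTranspose_one, one_mul] at hX hY hXY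
  rw [trace_mul_kronecker_one] at hX
  rw [trace_mul_one_kronecker] at hY
  rw [mul_one] at hXY
  rw [← hX, ← hY, ← hXY]
  refine (pow_le_pow_left₀ (norm_nonneg _) (norm_inner_le_norm _ _) 2).trans_eq ?_
  rw [mul_pow, mul_comm, ← inner_self_eq_norm_sq (𝕜 := ℂ), ← inner_self_eq_norm_sq (𝕜 := ℂ)]
  rfl

theorem inner_toEuclideanLin_eigenvectorBasis {m n : Type*} [Fintype m] [Fintype n]
    [DecidableEq n] (M : Matrix m n ℂ) (j : n) (y : EuclideanSpace ℂ n) :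
    ⟪M.toEuclideanLin ((posSemidef_conjTranspose_mul_self M).1.eigenvectorBasis j),
        M.toEuclideanLin y⟫_ℂ =
      (posSemidef_conjTranspose_mul_self M).1.eigenvalues j *
        ⟪(posSemidef_conjTranspose_mul_self M).1.eigenvectorBasis j, y⟫_ℂ := by
  have h := (posSemidef_conjTranspose_mul_self M).1.mulVec_eigenvectorBasis j
  rw [toLpLin_apply, toLpLin_apply, EuclideanSpace.inner_toLp_toLp, star_mulVec, dotProduct_comm,
    ← dotProduct_mulVec, mulVec_mulVec, dotProduct_comm, EuclideanSpace.inner_eq_star_dotProduct]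
  have h2 := congrArg star h
  rw [star_mulVec, conjTranspose_mul, conjTranspose_conjTranspose] at h2
  rw [dotProduct_comm, dotProduct_mulVec, h2]
  simp [star_smul, dotProduct_comm]

/-- The Schmidt coefficients of `ρ̃ = (I ⊗ ρ_B^{-1/2}) ρ (ρ_A^{-1/2} ⊗ I)`, i.e. the singular
values of its realignment, have largest value `1` and second largest value `μ(ρ)`. -/
theorem schmidt_coefficients_of_normalized_state
    {dA dB : ℕ} (ρ : Matrix (Fin dA × Fin dB) (Fin dA × Fin dB) ℂ)
    (hρ : IsDensity ρ) (hA : IsUnit (ptrB ρ)) (hB : IsUnit (ptrA ρ)) :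
    ∃ j₀ : Fin dB × Fin dB,
      (∀ j, Real.sqrt ((Matrix.posSemidef_conjTranspose_mul_self
              (realign ((1 ⊗ₖ invSqrt (ptrA ρ)) * ρ * (invSqrt (ptrB ρ) ⊗ₖ 1)))).1.eigenvalues j)
          ≤ Real.sqrt ((Matrix.posSemidef_conjTranspose_mul_self
              (realign ((1 ⊗ₖ invSqrt (ptrA ρ)) * ρ * (invSqrt (ptrB ρ) ⊗ₖ 1)))).1.eigenvalues j₀)) ∧
      Real.sqrt ((Matrix.posSemidef_conjTranspose_mul_self
          (realign ((1 ⊗ₖ invSqrt (ptrA ρ)) * ρ * (invSqrt (ptrB ρ) ⊗ₖ 1)))).1.eigenvalues j₀) = 1 ∧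
      mu ρ = ⨆ j : {j : Fin dB × Fin dB // j ≠ j₀},
        Real.sqrt ((Matrix.posSemidef_conjTranspose_mul_self
          (realign ((1 ⊗ₖ invSqrt (ptrA ρ)) * ρ * (invSqrt (ptrB ρ) ⊗ₖ 1)))).1.eigenvalues j) := by
  obtain ⟨hρ, htr⟩ := hρ
  have hρA := hρ.ptrB
  have hρB := hρ.ptrA
  set M := realign ((1 ⊗ₖ invSqrt (ptrA ρ)) * ρ * (invSqrt (ptrB ρ) ⊗ₖ 1)) with hM
  let φ : Matrix (Fin dA) (Fin dA) ℂ → EuclideanSpace ℂ (Fin dA × Fin dA) :=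
    fun X => WithLp.toLp 2 (star (vec (hρA.sqrt * X)))
  let ψ : Matrix (Fin dB) (Fin dB) ℂ → EuclideanSpace ℂ (Fin dB × Fin dB) :=
    fun Y => WithLp.toLp 2 (star (vec (hρB.sqrt * Y)ᵀ))
  have hφ : ∀ X X', ⟪φ X, φ X'⟫_ℂ = (ptrB ρ * (X * X'ᴴ)).trace := by
    intro X X'
    rw [EuclideanSpace.inner_toLp_toLp, star_star, star_vec_dotProduct_vec, conjTranspose_mul,
      hρA.conjTranspose_sqrt, Matrix.mul_assoc, ← Matrix.mul_assoc hρA.sqrt, hρA.sqrt_mul_sqrt,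
      trace_mul_comm, Matrix.mul_assoc]
  have hψ : ∀ Y Y', ⟪ψ Y, ψ Y'⟫_ℂ = (ptrA ρ * (Y * Y'ᴴ)).trace := by
    intro Y Y'
    have hT : (hρB.sqrt * Y')ᵀᴴ = (hρB.sqrt * Y')ᴴᵀ := rfl
    rw [EuclideanSpace.inner_toLp_toLp, star_star, star_vec_dotProduct_vec, hT, ← transpose_mul, trace_transpose, conjTranspose_mul,
      hρB.conjTranspose_sqrt, ← Matrix.mul_assoc, trace_mul_comm, ← Matrix.mul_assoc,
      ← Matrix.mul_assoc, hρB.sqrt_mul_sqrt, Matrix.mul_assoc]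
  have hφψ : ∀ X Y, ⟪φ X, M.toEuclideanLin (ψ Y)⟫_ℂ = (ρ * (X ⊗ₖ Yᴴ)).trace := by
    intro X Y
    rw [toLpLin_toLp, EuclideanSpace.inner_toLp_toLp, star_star, dotProduct_comm, toLin'_apply, hM,
      vec_dotProduct_realign_mulVec, trace_normalized_mul_kronecker hρA hρB hA hB]
  have hφs : Function.Surjective φ := by
    intro x
    refine ⟨hρA.sqrt⁻¹ * of fun i k => star (x (k, i)), ?_⟩
    ext p
    simp only [φ, mul_nonsing_inv_cancel_left _ _ (hρA.isUnit_sqrt hA)]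
    simp [Function.uncurry, flip]
  have hψs : Function.Surjective ψ := by
    intro y
    refine ⟨hρB.sqrt⁻¹ * of fun j l => star (y (j, l)), ?_⟩
    ext p
    simp only [ψ, mul_nonsing_inv_cancel_left _ _ (hρB.isUnit_sqrt hB)]
    simp
  have hφn : ∀ X, (ptrB ρ * (X * Xᴴ)).trace = ((‖φ X‖ ^ 2 : ℝ) : ℂ) := fun X => by
    rw [← hφ, inner_self_eq_norm_sq_to_K]
    simp
  have hφ1 : ∀ X, (ptrB ρ * (X * Xᴴ)).trace = 1 ↔ ‖φ X‖ = 1 := fun X => by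
    rw [hφn, Complex.ofReal_eq_one, pow_eq_one_iff_of_nonneg (norm_nonneg _) two_ne_zero]
  have hψn : ∀ Y, (ptrA ρ * (Y * Yᴴ)).trace = ((‖ψ Y‖ ^ 2 : ℝ) : ℂ) := fun Y => by
    rw [← hψ, inner_self_eq_norm_sq_to_K]
    simp
  have hψ1 : ∀ Y, (ptrA ρ * (Y * Yᴴ)).trace = 1 ↔ ‖ψ Y‖ = 1 := fun Y => by
    rw [hψn, Complex.ofReal_eq_one, pow_eq_one_iff_of_nonneg (norm_nonneg _) two_ne_zero]
  have hM1 : M.toEuclideanLin (ψ 1) = φ 1 := by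
    refine ext_inner_left ℂ fun x => ?_
    obtain ⟨X, rfl⟩ := hφs x
    rw [hφψ, hφ, conjTranspose_one, conjTranspose_one, trace_mul_kronecker_one, mul_one]
  have hc : ∀ y, ‖M.toEuclideanLin y‖ ≤ ‖y‖ := by
    intro y
    obtain ⟨Y, rfl⟩ := hψs y
    obtain ⟨X, hX⟩ := hφs (M.toEuclideanLin (ψ Y))
    have h := norm_trace_mul_kronecker_sq_le hρ X Y
    rw [← hφψ, hφn, hψn, ← hX, inner_self_eq_norm_sq_to_K, norm_pow, Complex.ofReal_re,
      Complex.ofReal_re, RCLike.norm_ofReal, abs_norm, sq (‖φ X‖ ^ 2)] at h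
    rw [← hX]
    rcases (norm_nonneg (φ X)).eq_or_lt with h0 | h0
    · exact h0 ▸ norm_nonneg _
    · exact le_of_sq_le_sq (le_of_mul_le_mul_left h (by positivity)) (norm_nonneg _)
  obtain ⟨j₀, h₁, h₂, h₃⟩ := sSup_norm_inner_map_orthogonal_eq_iSup M.toEuclideanLin
    (posSemidef_conjTranspose_mul_self M).1.eigenvectorBasis
    (posSemidef_conjTranspose_mul_self M).1.eigenvalues
    (inner_toEuclideanLin_eigenvectorBasis M) hc (ψ 1)
    ((hψ1 1).1 (by
      rw [conjTranspose_one, one_mul, ← trace_mul_one_kronecker, one_kronecker_one, mul_one, htr])) (fun y => by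
      obtain ⟨Y, rfl⟩ := hψs y
      rw [hM1, hφψ, hψ, trace_mul_one_kronecker, one_mul])
  refine ⟨j₀, h₁, h₂, ?_⟩
  rw [← h₃, mu]
  congr 1
  ext r
  simp only [Set.mem_ofPred_eq, hM1, hφs.exists, hψs.exists, hφψ, hφ, hψ, hφ1, hψ1,
    conjTranspose_one, mul_one]
end
end

section
/- If for some n ≥ 1 the n-fold tensor power ρ_AB^{⊗n} can be locally transformed to σ_EF, i.e., σ_EF = (Φ ⊗ Ψ)(ρ_AB^{⊗n}) for some completely positive trace-preserving maps Φ acting on the n A-systems and Ψ acting on the n B-systems, then μ(ρ_AB) ≥ μ(σ_EF). -/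
open scoped Matrix Kronecker ComplexOrder
open Matrix

noncomputable section

/-- The operators spanning `M_A ⊗ 1` and `1 ⊗ M_B`: matrix units acting on one of the two sides. -/
def localUnit {A B : Type*} [DecidableEq A] [DecidableEq B] (x w : A × B) :
    A × A ⊕ B × B → ℂ
  | .inl p => (if x.1 = p.1 then 1 else 0) * (if w.1 = p.2 then 1 else 0) *
      (if x.2 = w.2 then 1 else 0)
  | .inr p => (if x.2 = p.1 then 1 else 0) * (if w.2 = p.2 then 1 else 0) *
      (if x.1 = w.1 then 1 else 0)

/-- The expectations of the local matrix units. -/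
def localMean {A B : Type*} [Fintype A] [Fintype B] (ρ : Matrix (A × B) (A × B) ℂ) :
    A × A ⊕ B × B → ℂ
  | .inl p => ptrB ρ p.2 p.1
  | .inr p => ptrA ρ p.2 p.1

/-- The Gram matrix of the local matrix units for the form `(S, T) ↦ tr (Sᴴ ρ T)`. -/
def localGram {A B : Type*} [Fintype A] [Fintype B] [DecidableEq A] [DecidableEq B]
    (ρ : Matrix (A × B) (A × B) ℂ) : Matrix (A × A ⊕ B × B) (A × A ⊕ B × B) ℂ
  | .inl p, .inl q => if p.2 = q.2 then ptrB ρ p.1 q.1 else 0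
  | .inl p, .inr q => ρ (p.1, q.2) (p.2, q.1)
  | .inr p, .inl q => ρ (q.2, p.1) (q.1, p.2)
  | .inr p, .inr q => if p.2 = q.2 then ptrA ρ p.1 q.1 else 0

/-- The weight `c` on the diagonal blocks and `1` on the off-diagonal blocks. -/
def blockWeight {α β : Type*} (c : ℝ) : α ⊕ β → α ⊕ β → ℂ
  | .inl _, .inl _ => c
  | .inr _, .inr _ => c
  | _, _ => 1

/-- The block matrix whose positivity expresses that covariances between the two sides are
bounded by `c` times the standard deviations. -/
def localCov {A B : Type*} [Fintype A] [Fintype B] [DecidableEq A] [DecidableEq B]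
    (ρ : Matrix (A × B) (A × B) ℂ) (c : ℝ) : Matrix (A × A ⊕ B × B) (A × A ⊕ B × B) ℂ :=
  fun p q => blockWeight c p q * (localGram ρ p q - star (localMean ρ p) * localMean ρ q)

section OneState

variable {A B : Type*} [Fintype A] [Fintype B]

theorem trace_ptrB_mul [DecidableEq B] (ρ : Matrix (A × B) (A × B) ℂ) (X : Matrix A A ℂ) :
    (ptrB ρ * X).trace = (ρ * (X ⊗ₖ (1 : Matrix B B ℂ))).trace := by
  simp only [Matrix.trace, Matrix.diag, Matrix.mul_apply, ptrB, Matrix.kroneckerMap_apply,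
    Fintype.sum_prod_type, Matrix.one_apply, mul_ite, mul_one, mul_zero, Finset.sum_ite_eq',
    Finset.mem_univ, if_true, Finset.sum_mul]
  exact Finset.sum_congr rfl fun _ _ => Finset.sum_comm

theorem trace_ptrA_mul [DecidableEq A] (ρ : Matrix (A × B) (A × B) ℂ) (Y : Matrix B B ℂ) :
    (ptrA ρ * Y).trace = (ρ * ((1 : Matrix A A ℂ) ⊗ₖ Y)).trace := by
  simp only [Matrix.trace, Matrix.diag, Matrix.mul_apply, ptrA, Matrix.kroneckerMap_apply,
    Fintype.sum_prod_type, Matrix.one_apply, ite_mul, one_mul, zero_mul, mul_ite, mul_zero,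
    Finset.sum_mul]
  simp only [Finset.sum_ite_irrel, Finset.sum_const_zero, Finset.sum_ite_eq', Finset.mem_univ,
    if_true]
  symm
  rw [Finset.sum_comm]
  exact Finset.sum_congr rfl fun _ _ => Finset.sum_comm

omit [Fintype A] in
theorem ptrB_posSemidef {ρ : Matrix (A × B) (A × B) ℂ} (hρ : ρ.PosSemidef) :
    (ptrB ρ).PosSemidef := by
  have : ptrB ρ = ∑ k : B, ρ.submatrix (fun i => (i, k)) (fun i => (i, k)) := by
    ext i j
    simp [ptrB, Matrix.sum_apply]
  rw [this]
  exact Matrix.posSemidef_sum _ fun k _ => hρ.submatrix _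

omit [Fintype B] in
theorem ptrA_posSemidef {ρ : Matrix (A × B) (A × B) ℂ} (hρ : ρ.PosSemidef) :
    (ptrA ρ).PosSemidef := by
  have : ptrA ρ = ∑ k : A, ρ.submatrix (fun i => (k, i)) (fun i => (k, i)) := by
    ext i j
    simp [ptrA, Matrix.sum_apply]
  rw [this]
  exact Matrix.posSemidef_sum _ fun k _ => hρ.submatrix _

theorem trace_mul_self_conjTranspose_nonneg {m n : Type*} [Fintype m] [Fintype n]
    {M : Matrix m m ℂ} (hM : M.PosSemidef) (X : Matrix m n ℂ) :
    0 ≤ (M * (X * Xᴴ)).trace := by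
  rw [← Matrix.mul_assoc, Matrix.trace_mul_comm, ← Matrix.mul_assoc]
  exact (hM.conjTranspose_mul_mul_same X).trace_nonneg

variable [DecidableEq A] [DecidableEq B]

theorem localGram_posSemidef {ρ : Matrix (A × B) (A × B) ℂ} (hρ : ρ.PosSemidef) :
    (localGram ρ).PosSemidef := by
  have : localGram ρ = ∑ w : A × B,
      (Matrix.of fun x p => localUnit x w p)ᴴ * ρ * (Matrix.of fun x p => localUnit x w p) := by
    ext p q
    rcases p with ⟨i, j⟩ | ⟨i, j⟩ <;> rcases q with ⟨k, l⟩ | ⟨k, l⟩ <;>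
      simp [localGram, localUnit, Matrix.sum_apply, Matrix.mul_apply, Fintype.sum_prod_type,
        ptrA, ptrB, apply_ite]
    all_goals split_ifs with h <;> intro hj <;>
      first | exact absurd h.symm hj | exact absurd hj.symm h
  rw [this]
  exact Matrix.posSemidef_sum _ fun w _ => hρ.conjTranspose_mul_mul_same _

end OneState

section QuadraticForm

variable {A B : Type*} [Fintype A] [Fintype B]

/-- The coefficients of `X ⊗ 1 + 1 ⊗ Y` in the local matrix units. -/
def localCoeff {A B : Type*} (X : Matrix A A ℂ) (Y : Matrix B B ℂ) : A × A ⊕ B × B → ℂ :=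
  Sum.elim (fun p => X p.1 p.2) (fun p => Y p.1 p.2)

theorem trace_mul_conjTranspose_kronecker {ρ : Matrix (A × B) (A × B) ℂ} (hρ : ρ.IsHermitian)
    (X : Matrix A A ℂ) (Y : Matrix B B ℂ) :
    (ρ * (Xᴴ ⊗ₖ Y)).trace = star (ρ * (X ⊗ₖ Yᴴ)).trace := by
  rw [← Matrix.trace_conjTranspose, Matrix.conjTranspose_mul, Matrix.conjTranspose_kronecker,
    Matrix.conjTranspose_conjTranspose, hρ.eq, Matrix.trace_mul_comm]

theorem trace_mul_conjTranspose {n : Type*} [Fintype n] {M : Matrix n n ℂ} (hM : M.IsHermitian)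
    (X : Matrix n n ℂ) : (M * Xᴴ).trace = star (M * X).trace := by
  rw [← Matrix.trace_conjTranspose, Matrix.conjTranspose_mul, hM.eq, Matrix.trace_mul_comm]

theorem sum_star_mul_sub_mul {α β : Type*} [Fintype α] [Fintype β] (x m : α → ℂ) (y m' : β → ℂ)
    (g : α → β → ℂ) (c : ℂ) :
    ∑ p, ∑ q, star (x p) * ((c * (g p q - star (m p) * m' q)) * y q) =
      c * (∑ p, ∑ q, star (x p) * (g p q * y q) - star (∑ p, m p * x p) * ∑ q, m' q * y q) := by
  rw [star_sum, Finset.sum_mul_sum, ← Finset.sum_sub_distrib, Finset.mul_sum]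
  refine Finset.sum_congr rfl fun p _ => ?_
  rw [← Finset.sum_sub_distrib, Finset.mul_sum]
  refine Finset.sum_congr rfl fun q _ => ?_
  rw [star_mul']
  ring

theorem sum_star_mul_diag {n : Type*} [Fintype n] [DecidableEq n] (M X : Matrix n n ℂ) :
    ∑ p : n × n, ∑ q : n × n,
      star (X p.1 p.2) * ((if p.2 = q.2 then M p.1 q.1 else 0) * X q.1 q.2) =
      (M * (X * Xᴴ)).trace := by
  simp only [Matrix.trace, Matrix.diag, Matrix.mul_apply, Matrix.conjTranspose_apply,
    Fintype.sum_prod_type, ite_mul, zero_mul, mul_ite, mul_zero, Finset.sum_ite_eq,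
    Finset.mem_univ, if_true, Finset.mul_sum]
  refine Finset.sum_congr rfl fun i _ => ?_
  rw [Finset.sum_comm]
  exact Finset.sum_congr rfl fun _ _ => Finset.sum_congr rfl fun _ _ => by ring

theorem sum_star_mul_cross (ρ : Matrix (A × B) (A × B) ℂ) (X : Matrix A A ℂ) (Y : Matrix B B ℂ) :
    ∑ p : A × A, ∑ q : B × B, star (X p.1 p.2) * (ρ (p.1, q.2) (p.2, q.1) * Y q.1 q.2) =
      (ρ * (Xᴴ ⊗ₖ Y)).trace := by
  simp only [Matrix.trace, Matrix.diag, Matrix.mul_apply, Matrix.conjTranspose_apply,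
    Fintype.sum_prod_type, Matrix.kroneckerMap_apply]
  refine Finset.sum_congr rfl fun i _ => ?_
  conv_rhs => rw [Finset.sum_comm]
  refine Finset.sum_congr rfl fun j _ => ?_
  rw [Finset.sum_comm]
  exact Finset.sum_congr rfl fun _ _ => Finset.sum_congr rfl fun _ _ => by ring

theorem sum_star_mul_cross' (ρ : Matrix (A × B) (A × B) ℂ) (X : Matrix A A ℂ)
    (Y : Matrix B B ℂ) :
    ∑ q : B × B, ∑ p : A × A, star (Y q.1 q.2) * (ρ (p.2, q.1) (p.1, q.2) * X p.1 p.2) =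
      (ρ * (X ⊗ₖ Yᴴ)).trace := by
  simp only [Matrix.trace, Matrix.diag, Matrix.mul_apply, Matrix.conjTranspose_apply,
    Fintype.sum_prod_type, Matrix.kroneckerMap_apply]
  conv_rhs => rw [Finset.sum_comm]
  refine Finset.sum_congr rfl fun k _ => ?_
  rw [Finset.sum_comm]
  conv_rhs => rw [Finset.sum_comm]
  refine Finset.sum_congr rfl fun i _ => ?_
  rw [Finset.sum_comm]
  exact Finset.sum_congr rfl fun _ _ => Finset.sum_congr rfl fun _ _ => by ring

theorem sum_localMean_mul {n : Type*} [Fintype n] (M X : Matrix n n ℂ) :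
    ∑ p : n × n, M p.2 p.1 * X p.1 p.2 = (M * X).trace := by
  simp only [Matrix.trace, Matrix.diag, Matrix.mul_apply, Fintype.sum_prod_type]
  exact Finset.sum_comm

variable [DecidableEq A] [DecidableEq B]

theorem localGram_quadForm {ρ : Matrix (A × B) (A × B) ℂ} (hρ : ρ.IsHermitian)
    (X : Matrix A A ℂ) (Y : Matrix B B ℂ) :
    star (localCoeff X Y) ⬝ᵥ (localGram ρ *ᵥ localCoeff X Y) =
      (ptrB ρ * (X * Xᴴ)).trace + (ptrA ρ * (Y * Yᴴ)).trace +
      ((ρ * (X ⊗ₖ Yᴴ)).trace + star (ρ * (X ⊗ₖ Yᴴ)).trace) := by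
  simp only [dotProduct, mulVec, Fintype.sum_sum_type, Finset.mul_sum, Pi.star_apply, localCoeff,
    Sum.elim_inl, Sum.elim_inr, localGram, mul_add, Finset.sum_add_distrib]
  rw [sum_star_mul_diag, sum_star_mul_diag, sum_star_mul_cross, sum_star_mul_cross',
    trace_mul_conjTranspose_kronecker hρ]
  ring

theorem localCov_quadForm {ρ : Matrix (A × B) (A × B) ℂ} (hρ : ρ.IsHermitian) (c : ℝ)
    (X : Matrix A A ℂ) (Y : Matrix B B ℂ) :
    star (localCoeff X Y) ⬝ᵥ (localCov ρ c *ᵥ localCoeff X Y) =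
      c * ((ptrB ρ * (X * Xᴴ)).trace - star (ptrB ρ * X).trace * (ptrB ρ * X).trace) +
      c * ((ptrA ρ * (Y * Yᴴ)).trace - star (ptrA ρ * Y).trace * (ptrA ρ * Y).trace) +
      (((ρ * (X ⊗ₖ Yᴴ)).trace - star (ptrA ρ * Y).trace * (ptrB ρ * X).trace) +
        star ((ρ * (X ⊗ₖ Yᴴ)).trace - star (ptrA ρ * Y).trace * (ptrB ρ * X).trace)) := by
  simp only [dotProduct, mulVec, Fintype.sum_sum_type, Finset.mul_sum, Pi.star_apply, localCoeff,
    Sum.elim_inl, Sum.elim_inr, localCov, blockWeight, mul_add, Finset.sum_add_distrib]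
  rw [sum_star_mul_sub_mul, sum_star_mul_sub_mul, sum_star_mul_sub_mul, sum_star_mul_sub_mul]
  simp only [localGram, localMean]
  rw [sum_star_mul_diag, sum_star_mul_diag, sum_star_mul_cross, sum_star_mul_cross',
    trace_mul_conjTranspose_kronecker hρ, sum_localMean_mul, sum_localMean_mul]
  simp only [star_sub, star_mul', star_star]
  ring

theorem trace_ptrB_sub_smul_one {ρ : Matrix (A × B) (A × B) ℂ} (hρ : IsDensity ρ)
    (X : Matrix A A ℂ) (m : ℂ) : (ptrB ρ * (X - m • 1)).trace = (ptrB ρ * X).trace - m := by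
  have h1 : (ptrB ρ * 1).trace = 1 := by
    rw [trace_ptrB_mul, Matrix.one_kronecker_one, Matrix.mul_one, hρ.2]
  rw [Matrix.mul_sub, Matrix.trace_sub, Matrix.mul_smul, Matrix.trace_smul, h1, smul_eq_mul,
    mul_one]

theorem trace_ptrA_sub_smul_one {ρ : Matrix (A × B) (A × B) ℂ} (hρ : IsDensity ρ)
    (Y : Matrix B B ℂ) (m : ℂ) : (ptrA ρ * (Y - m • 1)).trace = (ptrA ρ * Y).trace - m := by
  have h1 : (ptrA ρ * 1).trace = 1 := by
    rw [trace_ptrA_mul, Matrix.one_kronecker_one, Matrix.mul_one, hρ.2]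
  rw [Matrix.mul_sub, Matrix.trace_sub, Matrix.mul_smul, Matrix.trace_smul, h1, smul_eq_mul,
    mul_one]

theorem trace_centered_mul_self {n : Type*} [Fintype n] [DecidableEq n] {M : Matrix n n ℂ}
    (hM : M.IsHermitian) (h1 : M.trace = 1) (X : Matrix n n ℂ) :
    (M * ((X - (M * X).trace • 1) * (X - (M * X).trace • 1)ᴴ)).trace =
      (M * (X * Xᴴ)).trace - star (M * X).trace * (M * X).trace := by
  simp only [Matrix.conjTranspose_sub, Matrix.conjTranspose_smul, Matrix.conjTranspose_one,
    Matrix.mul_sub, Matrix.sub_mul, Matrix.mul_smul, Matrix.smul_mul, Matrix.trace_sub,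
    Matrix.trace_smul, Matrix.mul_one, Matrix.one_mul, trace_mul_conjTranspose hM, h1, smul_eq_mul]
  ring

theorem trace_centered_kronecker {ρ : Matrix (A × B) (A × B) ℂ} (hρ : IsDensity ρ)
    (X : Matrix A A ℂ) (Y : Matrix B B ℂ) :
    (ρ * ((X - (ptrB ρ * X).trace • 1) ⊗ₖ (Y - (ptrA ρ * Y).trace • 1)ᴴ)).trace =
      (ρ * (X ⊗ₖ Yᴴ)).trace - star (ptrA ρ * Y).trace * (ptrB ρ * X).trace := by
  have hsub : (X - (ptrB ρ * X).trace • (1 : Matrix A A ℂ)) ⊗ₖ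
      (Y - (ptrA ρ * Y).trace • (1 : Matrix B B ℂ))ᴴ =
      X ⊗ₖ Yᴴ - star (ptrA ρ * Y).trace • (X ⊗ₖ (1 : Matrix B B ℂ)) -
        (ptrB ρ * X).trace • ((1 : Matrix A A ℂ) ⊗ₖ Yᴴ) +
        ((ptrB ρ * X).trace * star (ptrA ρ * Y).trace) • (1 : Matrix (A × B) (A × B) ℂ) := by
    rw [← Matrix.one_kronecker_one]
    ext ⟨i, k⟩ ⟨j, l⟩
    simp only [Matrix.kroneckerMap_apply, Matrix.sub_apply, Matrix.add_apply, Matrix.smul_apply,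
      Matrix.conjTranspose_sub, Matrix.conjTranspose_smul, Matrix.conjTranspose_one, smul_eq_mul]
    ring
  rw [hsub]
  simp only [Matrix.mul_sub, Matrix.mul_add, Matrix.mul_smul, Matrix.trace_sub, Matrix.trace_add,
    Matrix.trace_smul, ← trace_ptrB_mul, ← trace_ptrA_mul, Matrix.mul_one, hρ.2, smul_eq_mul,
    trace_mul_conjTranspose (ptrA_posSemidef hρ.1).isHermitian]
  ring

theorem exists_phase (b : ℂ) : ∃ z : ℂ, star z * z = 1 ∧ star z * b = -(‖b‖ : ℂ) := by
  obtain rfl | hb := eq_or_ne b 0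
  · exact ⟨1, by simp⟩
  have hn : (‖b‖ : ℂ) ≠ 0 := by simpa using hb
  have hsq : star b * b = (‖b‖ : ℂ) * ‖b‖ := by
    have := Complex.conj_mul' b
    rw [Complex.star_def, this, sq]
  refine ⟨-(b / ‖b‖), ?_, ?_⟩
  · simp only [star_neg, star_div₀, Complex.star_def, Complex.conj_ofReal] at hsq ⊢
    field_simp
    linear_combination hsq
  · simp only [star_neg, star_div₀, Complex.star_def, Complex.conj_ofReal] at hsq ⊢
    field_simp
    linear_combination -hsq

omit [DecidableEq A] [DecidableEq B] in
/-- A phase rotation turns a positive form into a bound on its off-diagonal part. -/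
theorem two_mul_norm_le_of_forall_nonneg {ρ : Matrix (A × B) (A × B) ℂ} {c : ℝ}
    {X : Matrix A A ℂ} {Y : Matrix B B ℂ}
    (h : ∀ z : ℂ, 0 ≤ c * (ptrB ρ * (X * Xᴴ)).trace +
      c * (ptrA ρ * ((z • Y) * (z • Y)ᴴ)).trace +
      ((ρ * (X ⊗ₖ (z • Y)ᴴ)).trace + star (ρ * (X ⊗ₖ (z • Y)ᴴ)).trace)) :
    2 * ‖(ρ * (X ⊗ₖ Yᴴ)).trace‖ ≤
      c * (ptrB ρ * (X * Xᴴ)).trace.re + c * (ptrA ρ * (Y * Yᴴ)).trace.re := by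
  obtain ⟨z, hz, hzb⟩ := exists_phase (ρ * (X ⊗ₖ Yᴴ)).trace
  have h := (Complex.nonneg_iff.1 (h z)).1
  have hYY : (z • Y) * (z • Y)ᴴ = Y * Yᴴ := by
    rw [Matrix.conjTranspose_smul, Matrix.smul_mul, Matrix.mul_smul, smul_smul, mul_comm z, hz,
      one_smul]
  have hXY : (ρ * (X ⊗ₖ (z • Y)ᴴ)).trace = -(‖(ρ * (X ⊗ₖ Yᴴ)).trace‖ : ℂ) := by
    rw [Matrix.conjTranspose_smul, Matrix.kronecker_smul, Matrix.mul_smul, Matrix.trace_smul,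
      smul_eq_mul, hzb]
  rw [hYY, hXY] at h
  simp at h
  linarith

theorem two_mul_norm_le_of_localCov {ρ : Matrix (A × B) (A × B) ℂ} (hρ : ρ.IsHermitian) {c : ℝ}
    (hc : (localCov ρ c).PosSemidef) {X : Matrix A A ℂ} {Y : Matrix B B ℂ}
    (hX : (ptrB ρ * X).trace = 0) (hY : (ptrA ρ * Y).trace = 0) :
    2 * ‖(ρ * (X ⊗ₖ Yᴴ)).trace‖ ≤
      c * (ptrB ρ * (X * Xᴴ)).trace.re + c * (ptrA ρ * (Y * Yᴴ)).trace.re := by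
  refine two_mul_norm_le_of_forall_nonneg fun z => ?_
  have h := hc.dotProduct_mulVec_nonneg (localCoeff X (z • Y))
  rw [localCov_quadForm hρ] at h
  simpa [hX, hY] using h

theorem two_mul_norm_le {ρ : Matrix (A × B) (A × B) ℂ} (hρ : ρ.PosSemidef)
    (X : Matrix A A ℂ) (Y : Matrix B B ℂ) :
    2 * ‖(ρ * (X ⊗ₖ Yᴴ)).trace‖ ≤
      (ptrB ρ * (X * Xᴴ)).trace.re + (ptrA ρ * (Y * Yᴴ)).trace.re := by
  have := two_mul_norm_le_of_forall_nonneg (c := 1) (ρ := ρ) (X := X) (Y := Y) fun z => by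
    have h := (localGram_posSemidef hρ).dotProduct_mulVec_nonneg (localCoeff X (z • Y))
    rw [localGram_quadForm hρ.isHermitian] at h
    simpa using h
  simpa using this

end QuadraticForm

section MaximalCorrelation

variable {A B : Type*} [Fintype A] [Fintype B]

theorem mu_nonneg (ρ : Matrix (A × B) (A × B) ℂ) : 0 ≤ mu ρ :=
  Real.sSup_nonneg fun _ ⟨_, _, _, _, _, _, hr⟩ => hr ▸ norm_nonneg _

theorem trace_mul_smul_self {n : Type*} [Fintype n] (M X : Matrix n n ℂ) (t : ℝ) :
    (M * (((t : ℂ) • X) * ((t : ℂ) • X)ᴴ)).trace = (t : ℂ) * t * (M * (X * Xᴴ)).trace := by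
  simp only [Matrix.conjTranspose_smul, Matrix.smul_mul, Matrix.mul_smul, Matrix.trace_smul,
    smul_eq_mul, Complex.star_def, Complex.conj_ofReal]
  ring

theorem trace_mul_smul_kronecker_smul (ρ : Matrix (A × B) (A × B) ℂ) (X : Matrix A A ℂ)
    (Y : Matrix B B ℂ) (s t : ℝ) :
    (ρ * (((s : ℂ) • X) ⊗ₖ ((t : ℂ) • Y)ᴴ)).trace = (s : ℂ) * t * (ρ * (X ⊗ₖ Yᴴ)).trace := by
  simp only [Matrix.conjTranspose_smul, Matrix.smul_kronecker, Matrix.kronecker_smul,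
    Matrix.mul_smul, Matrix.trace_smul, smul_eq_mul, Complex.star_def, Complex.conj_ofReal]
  ring

variable [DecidableEq A] [DecidableEq B]

theorem norm_trace_le_mu {ρ : Matrix (A × B) (A × B) ℂ} (hρ : ρ.PosSemidef)
    {X : Matrix A A ℂ} {Y : Matrix B B ℂ}
    (hX : (ptrB ρ * X).trace = 0) (hY : (ptrA ρ * Y).trace = 0)
    (hX1 : (ptrB ρ * (X * Xᴴ)).trace = 1) (hY1 : (ptrA ρ * (Y * Yᴴ)).trace = 1) :
    ‖(ρ * (X ⊗ₖ Yᴴ)).trace‖ ≤ mu ρ := by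
  refine le_csSup ⟨1, ?_⟩ ⟨X, Y, hX, hY, hX1, hY1, rfl⟩
  rintro r ⟨X, Y, -, -, hX1, hY1, rfl⟩
  have := two_mul_norm_le hρ X Y
  rw [hX1, hY1, Complex.one_re] at this
  linarith

theorem mul_mul_norm_le {ρ : Matrix (A × B) (A × B) ℂ} (hρ : ρ.PosSemidef)
    (X : Matrix A A ℂ) (Y : Matrix B B ℂ) {s t : ℝ} (hs : 0 ≤ s) (ht : 0 ≤ t) :
    2 * (s * t * ‖(ρ * (X ⊗ₖ Yᴴ)).trace‖) ≤
      s * s * (ptrB ρ * (X * Xᴴ)).trace.re + t * t * (ptrA ρ * (Y * Yᴴ)).trace.re := by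
  have := two_mul_norm_le hρ ((s : ℂ) • X) ((t : ℂ) • Y)
  rw [trace_mul_smul_self, trace_mul_smul_self, trace_mul_smul_kronecker_smul, norm_mul,
    norm_mul, Complex.norm_real, Complex.norm_real, Real.norm_of_nonneg hs,
    Real.norm_of_nonneg ht, ← Complex.ofReal_mul, ← Complex.ofReal_mul, Complex.re_ofReal_mul,
    Complex.re_ofReal_mul] at this
  exact this

theorem two_mul_norm_le_mu {ρ : Matrix (A × B) (A × B) ℂ} (hρ : ρ.PosSemidef)
    {X : Matrix A A ℂ} {Y : Matrix B B ℂ}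
    (hX : (ptrB ρ * X).trace = 0) (hY : (ptrA ρ * Y).trace = 0) :
    2 * ‖(ρ * (X ⊗ₖ Yᴴ)).trace‖ ≤
      mu ρ * (ptrB ρ * (X * Xᴴ)).trace.re + mu ρ * (ptrA ρ * (Y * Yᴴ)).trace.re := by
  obtain ⟨ha, ha'⟩ := Complex.nonneg_iff.1
    (trace_mul_self_conjTranspose_nonneg (ptrB_posSemidef hρ) X)
  obtain ⟨hd, hd'⟩ := Complex.nonneg_iff.1
    (trace_mul_self_conjTranspose_nonneg (ptrA_posSemidef hρ) Y)
  have hscale := fun s t hs ht => mul_mul_norm_le hρ X Y (s := s) (t := t) hs ht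
  have hnorm := fun (s t : ℝ) hX hY hX1 hY1 =>
    norm_trace_le_mu hρ (X := (s : ℂ) • X) (Y := (t : ℂ) • Y) hX hY hX1 hY1
  simp only [trace_mul_smul_self, trace_mul_smul_kronecker_smul, Matrix.mul_smul,
    Matrix.trace_smul, hX, hY, smul_zero, forall_const] at hnorm
  have hμ := mu_nonneg ρ
  have hae : (ptrB ρ * (X * Xᴴ)).trace = ((ptrB ρ * (X * Xᴴ)).trace.re : ℂ) :=
    Complex.ext rfl (by simpa using ha'.symm)
  have hde : (ptrA ρ * (Y * Yᴴ)).trace = ((ptrA ρ * (Y * Yᴴ)).trace.re : ℂ) :=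
    Complex.ext rfl (by simpa using hd'.symm)
  rw [hae, hde] at hnorm
  generalize (ptrB ρ * (X * Xᴴ)).trace.re = a at *
  generalize (ptrA ρ * (Y * Yᴴ)).trace.re = d at *
  have hb := norm_nonneg (ρ * (X ⊗ₖ Yᴴ)).trace
  have hpos : 0 ≤ mu ρ * a + mu ρ * d := by positivity
  rcases ha.eq_or_lt with rfl | ha
  · by_contra! hlt
    have hb0 : 0 < ‖(ρ * (X ⊗ₖ Yᴴ)).trace‖ := by linarith
    have := hscale ((d + 1) / ‖(ρ * (X ⊗ₖ Yᴴ)).trace‖) 1 (by positivity) zero_le_one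
    rw [mul_one, div_mul_cancel₀ _ hb0.ne'] at this
    linarith
  rcases hd.eq_or_lt with rfl | hd
  · by_contra! hlt
    have hb0 : 0 < ‖(ρ * (X ⊗ₖ Yᴴ)).trace‖ := by linarith
    have := hscale 1 ((a + 1) / ‖(ρ * (X ⊗ₖ Yᴴ)).trace‖) zero_le_one (by positivity)
    rw [one_mul, div_mul_cancel₀ _ hb0.ne'] at this
    linarith
  have key : ∀ x : ℝ, 0 < x → ((√x)⁻¹ : ℝ) * (√x)⁻¹ * x = 1 := fun x hx => by
    rw [← mul_inv, Real.mul_self_sqrt hx.le, inv_mul_cancel₀ hx.ne']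
  have h := hnorm (√a)⁻¹ (√d)⁻¹ (by exact_mod_cast key a ha) (by exact_mod_cast key d hd)
  rw [norm_mul, norm_mul, Complex.norm_real, Complex.norm_real, Real.norm_of_nonneg (by positivity),
    Real.norm_of_nonneg (by positivity), ← mul_inv, inv_mul_le_iff₀ (by positivity)] at h
  have h2 : 2 * (√a * √d) ≤ a + d := by
    nlinarith [sq_nonneg (√a - √d), Real.mul_self_sqrt ha.le, Real.mul_self_sqrt hd.le]
  nlinarith [mul_le_mul_of_nonneg_left h2 hμ]

theorem localCov_isHermitian {ρ : Matrix (A × B) (A × B) ℂ} (hρ : ρ.PosSemidef) (c : ℝ) :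
    (localCov ρ c).IsHermitian := by
  ext p q
  have h := (localGram_posSemidef hρ).isHermitian.apply p q
  have hw : star (blockWeight c q p) = blockWeight c p q := by
    cases p <;> cases q <;> simp [blockWeight]
  rw [Matrix.conjTranspose_apply, localCov, localCov, star_mul', star_sub, h, hw, star_mul',
    star_star, mul_comm (localMean ρ q)]

/-- The maximal correlation bounds all covariances. -/
theorem localCov_mu_posSemidef {ρ : Matrix (A × B) (A × B) ℂ} (hρ : IsDensity ρ) :
    (localCov ρ (mu ρ)).PosSemidef := by
  refine .of_dotProduct_mulVec_nonneg (localCov_isHermitian hρ.1 _) fun v => ?_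
  obtain ⟨X, Y, rfl⟩ : ∃ X Y, v = localCoeff X Y :=
    ⟨.of fun i j => v (.inl (i, j)), .of fun i j => v (.inr (i, j)), by
      ext (p | p) <;> simp [localCoeff]⟩
  have hA := ptrB_posSemidef hρ.1
  have hB := ptrA_posSemidef hρ.1
  have hA1 : (ptrB ρ).trace = 1 := by
    simpa [Matrix.one_kronecker_one, hρ.2] using trace_ptrB_mul ρ 1
  have hB1 : (ptrA ρ).trace = 1 := by
    simpa [Matrix.one_kronecker_one, hρ.2] using trace_ptrA_mul ρ 1
  have h := two_mul_norm_le_mu hρ.1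
    (X := X - (ptrB ρ * X).trace • 1) (Y := Y - (ptrA ρ * Y).trace • 1)
    (by rw [trace_ptrB_sub_smul_one hρ, sub_self]) (by rw [trace_ptrA_sub_smul_one hρ, sub_self])
  have ha := trace_mul_self_conjTranspose_nonneg hA (X - (ptrB ρ * X).trace • 1)
  have hd := trace_mul_self_conjTranspose_nonneg hB (Y - (ptrA ρ * Y).trace • 1)
  rw [localCov_quadForm hρ.1.isHermitian, ← trace_centered_mul_self hA.isHermitian hA1,
    ← trace_centered_mul_self hB.isHermitian hB1, ← trace_centered_kronecker hρ]
  rw [Complex.nonneg_iff] at ha hd ⊢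
  have hb := Complex.abs_re_le_norm (ρ * ((X - (ptrB ρ * X).trace • 1) ⊗ₖ
    (Y - (ptrA ρ * Y).trace • 1)ᴴ)).trace
  constructor
  · simp only [Complex.add_re, Complex.re_ofReal_mul, Complex.star_def, Complex.conj_re]
    linarith [neg_abs_le (ρ * ((X - (ptrB ρ * X).trace • 1) ⊗ₖ
      (Y - (ptrA ρ * Y).trace • 1)ᴴ)).trace.re]
  · simp only [Complex.add_im, Complex.im_ofReal_mul, Complex.star_def, Complex.conj_im, ← ha.2,
      ← hd.2]
    ring

end MaximalCorrelation

section TensorPower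

variable {A B : Type*}

theorem powState_succ (ρ : Matrix (A × B) (A × B) ℂ) (n : ℕ) :
    powState ρ (n + 1) = (ρ ⊗ₖ powState ρ n).submatrix
      (fun x => ((x.1 0, x.2 0), (Fin.tail x.1, Fin.tail x.2)))
      (fun x => ((x.1 0, x.2 0), (Fin.tail x.1, Fin.tail x.2))) := by
  ext x y
  simp [powState, Fin.prod_univ_succ, Fin.tail]

variable [Fintype A] [Fintype B]

theorem powState_posSemidef {ρ : Matrix (A × B) (A × B) ℂ} (hρ : ρ.PosSemidef) (n : ℕ) :
    (powState ρ n).PosSemidef := by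
  induction n with
  | zero =>
    have : powState ρ 0 = vecMulVec 1 (star 1) := by
      ext
      simp [powState, vecMulVec]
    rw [this]
    exact posSemidef_vecMulVec_self_star _
  | succ n ih =>
    rw [powState_succ]
    exact (hρ.kronecker ih).submatrix _

omit [Fintype A] in
theorem ptrB_powState (ρ : Matrix (A × B) (A × B) ℂ) (n : ℕ) (i j : Fin n → A) :
    ptrB (powState ρ n) i j = ∏ t, ptrB ρ (i t) (j t) := by
  simp only [ptrB, powState, Finset.prod_univ_sum, Fintype.piFinset_univ]

omit [Fintype B] in
theorem ptrA_powState (ρ : Matrix (A × B) (A × B) ℂ) (n : ℕ) (i j : Fin n → B) :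
    ptrA (powState ρ n) i j = ∏ t, ptrA ρ (i t) (j t) := by
  simp only [ptrA, powState, Finset.prod_univ_sum, Fintype.piFinset_univ]

/-- Splitting a local index of `n + 1` copies into the first copy and the rest. -/
def splitIndex {n : ℕ} : (Fin (n + 1) → A) × (Fin (n + 1) → A) ⊕
    (Fin (n + 1) → B) × (Fin (n + 1) → B) →
    (A × A ⊕ B × B) × ((Fin n → A) × (Fin n → A) ⊕ (Fin n → B) × (Fin n → B))
  | .inl p => (.inl (p.1 0, p.2 0), .inl (Fin.tail p.1, Fin.tail p.2))
  | .inr p => (.inr (p.1 0, p.2 0), .inr (Fin.tail p.1, Fin.tail p.2))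

theorem localMean_powState_succ (ρ : Matrix (A × B) (A × B) ℂ) (n : ℕ)
    (p : (Fin (n + 1) → A) × (Fin (n + 1) → A) ⊕ (Fin (n + 1) → B) × (Fin (n + 1) → B)) :
    localMean (powState ρ (n + 1)) p =
      localMean ρ (splitIndex p).1 * localMean (powState ρ n) (splitIndex p).2 := by
  cases p <;>
    simp [localMean, splitIndex, ptrB_powState, ptrA_powState, Fin.prod_univ_succ, Fin.tail]

theorem eq_iff_zero_and_tail {α : Type*} {n : ℕ} (f g : Fin (n + 1) → α) :
    f = g ↔ f 0 = g 0 ∧ Fin.tail f = Fin.tail g := by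
  simp only [funext_iff, Fin.forall_fin_succ, Fin.tail]

variable [DecidableEq A] [DecidableEq B]

theorem localGram_powState_succ (ρ : Matrix (A × B) (A × B) ℂ) (n : ℕ)
    (p q : (Fin (n + 1) → A) × (Fin (n + 1) → A) ⊕ (Fin (n + 1) → B) × (Fin (n + 1) → B)) :
    localGram (powState ρ (n + 1)) p q = localGram ρ (splitIndex p).1 (splitIndex q).1 *
      localGram (powState ρ n) (splitIndex p).2 (splitIndex q).2 := by
  cases p <;> cases q <;>
    simp only [localGram, splitIndex, ptrB_powState, ptrA_powState, Fin.prod_univ_succ, Fin.tail,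
      eq_iff_zero_and_tail, powState, ite_mul, mul_ite, mul_zero, zero_mul, ite_and]
  all_goals split_ifs <;> rfl

theorem localCov_powState_succ (ρ : Matrix (A × B) (A × B) ℂ) (c : ℝ) (n : ℕ) :
    localCov (powState ρ (n + 1)) c =
      (localCov ρ c ⊗ₖ localGram (powState ρ n) +
        vecMulVec (star (localMean ρ)) (localMean ρ) ⊗ₖ localCov (powState ρ n) c).submatrix
          splitIndex splitIndex := by
  ext p q
  have h1 : blockWeight c (splitIndex p).1 (splitIndex q).1 = blockWeight c p q := by
    cases p <;> cases q <;> rfl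
  have h2 : blockWeight c (splitIndex p).2 (splitIndex q).2 = blockWeight c p q := by
    cases p <;> cases q <;> rfl
  simp only [localCov, Matrix.submatrix_apply, Matrix.add_apply, Matrix.kroneckerMap_apply,
    vecMulVec_apply, Pi.star_apply, localGram_powState_succ, localMean_powState_succ, h1, h2,
    star_mul']
  ring

theorem localCov_powState_posSemidef {ρ : Matrix (A × B) (A × B) ℂ} (hρ : ρ.PosSemidef) {c : ℝ}
    (hc : (localCov ρ c).PosSemidef) (n : ℕ) : (localCov (powState ρ n) c).PosSemidef := by
  induction n with
  | zero =>
    have : localCov (powState ρ 0) c = 0 := by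
      ext (p | p) (q | q) <;>
        simp [localCov, localGram, localMean, ptrB_powState, ptrA_powState, powState,
          eq_iff_true_of_subsingleton]
    rw [this]
    exact .zero
  | succ n ih =>
    rw [localCov_powState_succ]
    exact ((hc.kronecker (localGram_posSemidef (powState_posSemidef hρ n))).add
      ((posSemidef_vecMulVec_star_self _).kronecker ih)).submatrix _

end TensorPower

section Channel

/-- The dual (Heisenberg picture) of the channel with Kraus operators `K`. -/
def dualChannel {A E ι : Type*} [Fintype E] [Fintype ι] (K : ι → Matrix E A ℂ)
    (X : Matrix E E ℂ) : Matrix A A ℂ :=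
  ∑ k, (K k)ᴴ * X * K k

variable {A B E F ι κ : Type*} [Fintype A] [Fintype B] [Fintype E] [Fintype F] [Fintype ι]
  [Fintype κ]

omit [Fintype A] in
theorem dualChannel_conjTranspose (K : ι → Matrix E A ℂ) (X : Matrix E E ℂ) :
    dualChannel K Xᴴ = (dualChannel K X)ᴴ := by
  simp [dualChannel, Matrix.conjTranspose_sum, Matrix.mul_assoc]

theorem trace_applyLocal_mul (K : ι → Matrix E A ℂ) (L : κ → Matrix F B ℂ)
    (ρ : Matrix (A × B) (A × B) ℂ) (X : Matrix E E ℂ) (Y : Matrix F F ℂ) :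
    (applyLocal K L ρ * (X ⊗ₖ Y)).trace =
      (ρ * (dualChannel K X ⊗ₖ dualChannel L Y)).trace := by
  have hsum : dualChannel K X ⊗ₖ dualChannel L Y =
      ∑ k, ∑ m, (K k ⊗ₖ L m)ᴴ * (X ⊗ₖ Y) * (K k ⊗ₖ L m) := by
    simp only [Matrix.conjTranspose_kronecker, ← Matrix.mul_kronecker_mul]
    ext ⟨i, k⟩ ⟨j, l⟩
    simp only [dualChannel, Matrix.kroneckerMap_apply, Matrix.sum_apply, Finset.sum_mul_sum]
  rw [hsum]
  simp only [applyLocal, Matrix.sum_mul, Matrix.mul_sum, Matrix.trace_sum]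
  refine Finset.sum_congr rfl fun k _ => Finset.sum_congr rfl fun m _ => ?_
  rw [Matrix.mul_assoc, Matrix.mul_assoc, Matrix.trace_mul_comm]
  simp only [Matrix.mul_assoc]

variable [DecidableEq A] [DecidableEq B]

/-- The Kadison–Schwarz inequality for the dual of a channel. -/
theorem trace_dualChannel_mul_le {M : Matrix A A ℂ} (hM : M.PosSemidef) {K : ι → Matrix E A ℂ}
    (hK : ∑ k, (K k)ᴴ * K k = 1) (X : Matrix E E ℂ) :
    (M * (dualChannel K X * (dualChannel K X)ᴴ)).trace ≤ (M * dualChannel K (X * Xᴴ)).trace := by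
  have key : dualChannel K (X * Xᴴ) - dualChannel K X * (dualChannel K X)ᴴ =
      ∑ k, ((K k)ᴴ * X - dualChannel K X * (K k)ᴴ) *
        ((K k)ᴴ * X - dualChannel K X * (K k)ᴴ)ᴴ := by
    have h1 : ∑ k, (K k)ᴴ * (X * (Xᴴ * K k)) = dualChannel K (X * Xᴴ) := by
      simp [dualChannel, Matrix.mul_assoc]
    have h2 : ∑ k, (K k)ᴴ * (X * (K k * (dualChannel K X)ᴴ)) =
        dualChannel K X * (dualChannel K X)ᴴ := by
      conv_rhs => rw [dualChannel, Matrix.sum_mul]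
      simp only [dualChannel, Matrix.mul_assoc]
    have h3 : ∑ k, dualChannel K X * ((K k)ᴴ * (Xᴴ * K k)) =
        dualChannel K X * (dualChannel K X)ᴴ := by
      rw [← Matrix.mul_sum, ← dualChannel_conjTranspose]
      simp only [dualChannel, Matrix.mul_assoc]
    have h4 : ∑ k, dualChannel K X * ((K k)ᴴ * (K k * (dualChannel K X)ᴴ)) =
        dualChannel K X * (dualChannel K X)ᴴ := by
      rw [← Matrix.mul_sum]
      simp only [← Matrix.mul_assoc (_)ᴴ, ← Matrix.sum_mul, hK, Matrix.one_mul]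
    simp only [Matrix.conjTranspose_sub, Matrix.conjTranspose_mul,
      Matrix.conjTranspose_conjTranspose, Matrix.sub_mul, Matrix.mul_sub, Matrix.mul_assoc, Finset.sum_sub_distrib, h1, h2, h3, h4]
    abel
  rw [← sub_nonneg, ← Matrix.trace_sub, ← Matrix.mul_sub, key, Matrix.mul_sum, Matrix.trace_sum]
  exact Finset.sum_nonneg fun k _ => trace_mul_self_conjTranspose_nonneg hM _

/-- Local channels preserve any bound on covariances. -/
theorem mu_applyLocal_le {ρ : Matrix (A × B) (A × B) ℂ} (hρ : ρ.PosSemidef) {c : ℝ} (hc0 : 0 ≤ c)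
    (hc : (localCov ρ c).PosSemidef) {K : ι → Matrix E A ℂ} {L : κ → Matrix F B ℂ}
    (hK : ∑ k, (K k)ᴴ * K k = 1) (hL : ∑ m, (L m)ᴴ * L m = 1) :
    mu (applyLocal K L ρ) ≤ c := by
  classical
  have hE (Z : Matrix E E ℂ) :
      (ptrB (applyLocal K L ρ) * Z).trace = (ptrB ρ * dualChannel K Z).trace := by
    rw [trace_ptrB_mul, trace_applyLocal_mul, trace_ptrB_mul]
    simp [dualChannel, hL]
  have hF (Z : Matrix F F ℂ) :
      (ptrA (applyLocal K L ρ) * Z).trace = (ptrA ρ * dualChannel L Z).trace := by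
    rw [trace_ptrA_mul, trace_applyLocal_mul, trace_ptrA_mul]
    simp [dualChannel, hK]
  refine Real.sSup_le ?_ hc0
  rintro r ⟨X, Y, hX, hY, hX1, hY1, rfl⟩
  rw [hE] at hX hX1
  rw [hF] at hY hY1
  rw [trace_applyLocal_mul, dualChannel_conjTranspose]
  have h := two_mul_norm_le_of_localCov hρ.isHermitian hc hX hY
  have ha := (Complex.le_def.1 (trace_dualChannel_mul_le (ptrB_posSemidef hρ) hK X)).1
  have hd := (Complex.le_def.1 (trace_dualChannel_mul_le (ptrA_posSemidef hρ) hL Y)).1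
  rw [hX1, Complex.one_re] at ha
  rw [hY1, Complex.one_re] at hd
  linarith [mul_le_mul_of_nonneg_left ha hc0, mul_le_mul_of_nonneg_left hd hc0]

end Channel

/-- If `ρ^{⊗n}` can be locally transformed to `σ`, then `μ(ρ) ≥ μ(σ)`. -/
theorem mu_ge_of_local_transform_pow {dA dB dE dF : ℕ} {ι κ : Type*} [Fintype ι] [Fintype κ]
    (ρ : Matrix (Fin dA × Fin dB) (Fin dA × Fin dB) ℂ) (hρ : IsDensity ρ)
    (n : ℕ) (hn : 1 ≤ n)
    (K : ι → Matrix (Fin dE) (Fin n → Fin dA) ℂ)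
    (L : κ → Matrix (Fin dF) (Fin n → Fin dB) ℂ)
    (hK : ∑ k, (K k)ᴴ * K k = 1) (hL : ∑ m, (L m)ᴴ * L m = 1)
    (σ : Matrix (Fin dE × Fin dF) (Fin dE × Fin dF) ℂ)
    (hσ : σ = applyLocal K L (powState ρ n)) :
    mu ρ ≥ mu σ := by
  subst hσ
  exact mu_applyLocal_le (powState_posSemidef hρ.1 n) (mu_nonneg ρ)
    (localCov_powState_posSemidef hρ.1 (localCov_mu_posSemidef hρ) n) hK hL
end
end
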